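/- Let T be a nondegenerate tetrahedron and 𝔅₄(T) = { v ∈ P₄(T) : ∫_F v q ds = 0 for all q ∈ P₂(F), all faces F }. Then div(𝔅₄(T)³) = { p ∈ P₃(T) : ∫_T p dx = 0 }. -/

import Mathlib

open MeasureTheory MvPolynomial
open scoped RealInnerProductSpace

noncomputable section

/-- Euclidean 3-space. -/
abbrev E3 := EuclideanSpace ℝ (Fin 3)

/-- Evaluate a polynomial in 3 variables at a point of `E3`. -/
def evalP (x : E3) (p : MvPolynomial (Fin 3) ℝ) : ℝ :=
  MvPolynomial.eval (fun j => x j) p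

/-- The (closed) facet of the tetrahedron opposite to vertex `i`. -/
def face (a : Fin 4 → E3) (i : Fin 4) : Set E3 :=
  convexHull ℝ (a '' {j | j ≠ i})

/-- The (closed) tetrahedron with vertices `a`. -/
def tetra (a : Fin 4 → E3) : Set E3 :=
  convexHull ℝ (Set.range a)

/-- The solid unit simplex in `ℝⁿ`. -/
def Sx (n : ℕ) : Set (Fin n → ℝ) := {y | (∀ i, 0 ≤ y i) ∧ ∑ i, y i ≤ 1}

/-- Affine parametrization of a simplex. -/
def ph {n : ℕ} (b : Fin (n + 1) → E3) (y : Fin n → ℝ) : E3 :=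
  b 0 + ∑ j, y j • (b j.succ - b 0)

lemma ph_apply {n : ℕ} (b : Fin (n + 1) → E3) (y : Fin n → ℝ) (k : Fin 3) :
    ph b y k = b 0 k + ∑ j, y j * (b j.succ k - b 0 k) := by
  simp [ph]

lemma Sx_closed (n : ℕ) : IsClosed (Sx n) := by
  have : Sx n = (⋂ i, {y : Fin n → ℝ | 0 ≤ y i}) ∩ {y | ∑ i, y i ≤ 1} := by
    ext y; simp [Sx]
  rw [this]
  refine IsClosed.inter (isClosed_iInter fun i => isClosed_le (by fun_prop) (by fun_prop))
    (isClosed_le (by fun_prop) (by fun_prop))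

lemma Sx_compact (n : ℕ) : IsCompact (Sx n) := by
  refine IsCompact.of_isClosed_subset (isCompact_Icc (a := (0 : Fin n → ℝ)) (b := 1))
    (Sx_closed n) ?_
  rintro y ⟨h0, h1⟩
  refine ⟨fun i => h0 i, fun i => ?_⟩
  exact (Finset.single_le_sum (fun j _ => h0 j) (Finset.mem_univ i)).trans h1

lemma Sx_meas (n : ℕ) : MeasurableSet (Sx n) := (Sx_closed n).measurableSet

lemma hull_eq {n : ℕ} (b : Fin (n + 1) → E3) :
    convexHull ℝ (Set.range b) = ph b '' Sx n := by
  have h : Set.range b = (∑ i, (LinearMap.proj (R := ℝ) (φ := fun _ => ℝ) i).smulRight (b i) :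
      (Fin (n + 1) → ℝ) →ₗ[ℝ] E3) '' (Set.range fun i : Fin (n + 1) => Pi.single i (1 : ℝ)) := by
    rw [← Set.range_comp]
    congr 1
    ext1 i
    simp [Pi.single_apply]
  rw [h, ← LinearMap.image_convexHull, convexHull_rangle_single_eq_stdSimplex]
  have key : ∀ w : Fin (n + 1) → ℝ, ∑ i, w i = 1 →
      (∑ i, (LinearMap.proj (R := ℝ) (φ := fun _ => ℝ) i).smulRight (b i) :
      (Fin (n + 1) → ℝ) →ₗ[ℝ] E3) w = ph b (fun j => w j.succ) := by
    intro w hw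
    rw [Fin.sum_univ_succ] at hw
    have hw0 : w 0 = 1 - ∑ j : Fin n, w j.succ := by linarith
    simp only [LinearMap.sum_apply, LinearMap.smulRight_apply, LinearMap.proj_apply, ph]
    rw [Fin.sum_univ_succ, hw0, sub_smul, one_smul, Finset.sum_smul]
    simp only [smul_sub, Finset.sum_sub_distrib]
    abel
  ext x
  constructor
  · rintro ⟨w, ⟨h0, h1⟩, rfl⟩
    refine ⟨fun j => w j.succ, ⟨fun j => h0 _, ?_⟩, (key w h1).symm⟩
    rw [Fin.sum_univ_succ] at h1
    have := h0 0
    linarith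
  · rintro ⟨y, ⟨h0, h1⟩, rfl⟩
    have hs : ∑ i, (Fin.cons (1 - ∑ j, y j) y : Fin (n + 1) → ℝ) i = 1 := by
      rw [Fin.sum_univ_succ]; simp
    refine ⟨Fin.cons (1 - ∑ j, y j) y, ⟨fun i => ?_, hs⟩, ?_⟩
    · refine Fin.cases ?_ (fun j => ?_) i
      · simpa using h1
      · simpa using h0 j
    · rw [key _ hs]; simp

/-- The linear part of `ph`. -/
def phL {n : ℕ} (b : Fin (n + 1) → E3) : EuclideanSpace ℝ (Fin n) →ₗ[ℝ] E3 :=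
  ∑ j, (LinearMap.proj (R := ℝ) (φ := fun _ => ℝ) j ∘ₗ
    (WithLp.linearEquiv 2 ℝ (Fin n → ℝ)).toLinearMap).smulRight (b j.succ - b 0)

lemma ph_eq {n : ℕ} (b : Fin (n + 1) → E3) (y : Fin n → ℝ) :
    ph b y = b 0 + phL b (WithLp.toLp 2 y) := by
  simp [ph, phL]

lemma phL_inj {n : ℕ} (b : Fin (n + 1) → E3) (hb : AffineIndependent ℝ b) :
    Function.Injective (phL b) := by
  rw [affineIndependent_iff_linearIndependent_vsub ℝ b 0] at hb
  have hli : LinearIndependent ℝ (fun j : Fin n => b j.succ - b 0) :=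
    hb.comp (fun j : Fin n => (⟨j.succ, Fin.succ_ne_zero j⟩ : {x // x ≠ (0 : Fin (n + 1))}))
      (fun i j h => by simpa using h)
  rw [← LinearMap.ker_eq_bot, LinearMap.ker_eq_bot']
  intro m hm
  have := Fintype.linearIndependent_iff.1 hli (fun j => m j) (by simpa [phL] using hm)
  ext j
  exact this j

lemma ph_inj {n : ℕ} (b : Fin (n + 1) → E3) (hb : AffineIndependent ℝ b) :
    Function.Injective (ph b) := by
  intro x y h
  rw [ph_eq, ph_eq, add_right_inj] at h
  have := phL_inj b hb h
  simpa using this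

lemma ph_cont {n : ℕ} (b : Fin (n + 1) → E3) : Continuous (ph b) := by
  unfold ph; fun_prop

open Measure Module in
lemma comap_haus {n : ℕ} (b : Fin (n + 1) → E3) (hb : AffineIndependent ℝ b) :
    ∃ C : ENNReal, C ≠ 0 ∧ C ≠ ⊤ ∧
      Measure.comap (ph b) (μH[(n : ℝ)] : Measure E3) = C • (volume : Measure (Fin n → ℝ)) := by
  have hemb : MeasurableEmbedding (ph b) :=
    (ph_cont b).measurableEmbedding (ph_inj b hb)
  have hfin : finrank ℝ (EuclideanSpace ℝ (Fin n)) = n := by simp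
  have haar : IsAddHaarMeasure (μH[(n : ℝ)] : Measure (EuclideanSpace ℝ (Fin n))) := by
    have := isAddHaarMeasure_hausdorffMeasure (E := EuclideanSpace ℝ (Fin n))
    rwa [hfin] at this
  set c := addHaarScalarFactor (μH[(n : ℝ)] : Measure (EuclideanSpace ℝ (Fin n))) volume with hc
  have hc0 : 0 < c := addHaarScalarFactor_pos_of_isAddHaarMeasure _ _
  have hμ : (μH[(n : ℝ)] : Measure (EuclideanSpace ℝ (Fin n))) = c • volume :=
    isAddLeftInvariant_eq_smul _ _
  have hnd : (phL b).normDet ≠ 0 :=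
    ((phL b).normDet_ne_zero_tfae.out 0 1).mpr (LinearMap.ker_eq_bot.2 (phL_inj b hb))
  have hnd' : 0 < (phL b).normDet :=
    lt_of_le_of_ne (LinearMap.normDet_nonneg _) hnd.symm
  refine ⟨ENNReal.ofReal (phL b).normDet * (c : ENNReal), ?_, ?_, ?_⟩
  · simp [hnd', hc0.ne']
  · exact ENNReal.mul_ne_top (by simp) (by simp)
  · ext s hs
    rw [hemb.comap_apply]
    have h1 : ph b '' s = (fun x => b 0 + x) '' (phL b '' (WithLp.toLp 2 '' s)) := by
      rw [Set.image_image, Set.image_image]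
      exact Set.image_congr fun y _ => ph_eq b y
    have h2 := LinearMap.hausdorffMeasure_image (phL b) (WithLp.toLp 2 '' s)
    rw [hfin] at h2
    rw [h1, (isometry_add_left (b 0)).hausdorffMeasure_image (by simp), h2, hμ]
    have h3 : (volume : Measure (EuclideanSpace ℝ (Fin n))) (WithLp.toLp 2 '' s) = volume s := by
      have h := (EuclideanSpace.volume_preserving_symm_measurableEquiv_toLp (Fin n)).symm
      rw [← h.measure_preimage_equiv]
      congr 1
      ext y; simp
    rw [Measure.smul_apply, Measure.smul_apply, h3, smul_eq_mul, mul_assoc]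
    rfl

lemma int_haus {n : ℕ} (b : Fin (n + 1) → E3) (hb : AffineIndependent ℝ b) :
    ∃ c : ℝ, c ≠ 0 ∧ ∀ f : E3 → ℝ,
      ∫ x in ph b '' Sx n, f x ∂(μH[(n : ℝ)]) = c * ∫ y in Sx n, f (ph b y) := by
  obtain ⟨C, h0, h1, h⟩ := comap_haus b hb
  have hemb : MeasurableEmbedding (ph b) :=
    (ph_cont b).measurableEmbedding (ph_inj b hb)
  refine ⟨C.toReal, ENNReal.toReal_ne_zero.2 ⟨h0, h1⟩, fun f => ?_⟩
  have e1 : ∫ y in Sx n, f (ph b y) ∂(Measure.comap (ph b) (μH[(n : ℝ)] : Measure E3))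
      = ∫ x in ph b '' Sx n, f x ∂(μH[(n : ℝ)]) := by
    have := hemb.setIntegral_map (μ := Measure.comap (ph b) (μH[(n : ℝ)] : Measure E3)) f
      (ph b '' Sx n)
    rw [hemb.map_comap, Set.preimage_image_eq _ hemb.injective] at this
    rw [← this, Measure.restrict_restrict, Set.inter_eq_left.2 (Set.image_subset_range _ _)]
    exact hemb.measurableSet_image.2 (Sx_meas n)
  rw [← e1, h, Measure.restrict_smul, integral_smul_measure, smul_eq_mul]

lemma face_int (a : Fin 4 → E3) (ha : AffineIndependent ℝ a) (i : Fin 4) (b : Fin 3 → Fin 4)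
    (hb : Function.Injective b) (hbi : ∀ m, b m ≠ i) :
    ∃ c : ℝ, c ≠ 0 ∧ ∀ f : E3 → ℝ,
      ∫ x in face a i, f x ∂(μH[2]) = c * ∫ y in Sx 2, f (ph (a ∘ b) y) := by
  have hr : Set.range b = {j | j ≠ i} := by
    apply Set.eq_of_subset_of_ncard_le
    · rintro _ ⟨m, rfl⟩; exact hbi m
    · rw [← Set.image_univ, Set.ncard_image_of_injective _ hb]
      have : {j : Fin 4 | j ≠ i} = ((Finset.univ.erase i : Finset (Fin 4)) : Set (Fin 4)) := by
        ext; simp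
      rw [this, Set.ncard_coe_finset]
      simp [Set.ncard_univ]
    · exact Set.toFinite _
  have hf : face a i = ph (a ∘ b) '' Sx 2 := by
    rw [← hull_eq, Set.range_comp, hr, face]
  obtain ⟨c, h0, h⟩ := int_haus (a ∘ b) (ha.comp_embedding ⟨b, hb⟩)
  refine ⟨c, h0, fun f => ?_⟩
  rw [hf]
  exact_mod_cast h f

open Measure Module in
lemma tetra_int (a : Fin 4 → E3) (ha : AffineIndependent ℝ a) :
    ∃ c : ℝ, c ≠ 0 ∧ ∀ f : E3 → ℝ,
      ∫ x in tetra a, f x = c * ∫ y in Sx 3, f (ph a y) := by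
  obtain ⟨c, h0, h⟩ := int_haus a ha
  have haar : IsAddHaarMeasure (μH[((3 : ℕ) : ℝ)] : Measure E3) := by
    have := isAddHaarMeasure_hausdorffMeasure (E := E3)
    rwa [show finrank ℝ E3 = 3 by simp] at this
  set d := addHaarScalarFactor (volume : Measure E3) (μH[((3 : ℕ) : ℝ)]) with hd
  have hd0 : 0 < d := addHaarScalarFactor_pos_of_isAddHaarMeasure _ _
  have hμ : (volume : Measure E3) = d • μH[((3 : ℕ) : ℝ)] := isAddLeftInvariant_eq_smul _ _
  refine ⟨d * c, mul_ne_zero (by exact_mod_cast hd0.ne') h0, fun f => ?_⟩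
  rw [hμ, tetra, hull_eq, Measure.restrict_smul, integral_smul_nnreal_measure, h f, mul_assoc]
  rfl

/-- Fubini on the simplex. -/
lemma Sx_fubini {n : ℕ} (k : Fin (n + 1)) (G : (Fin (n + 1) → ℝ) → ℝ) (hG : Continuous G) :
    ∫ x in Sx (n + 1), G x =
      ∫ y in Sx n, ∫ t in (0 : ℝ)..(1 - ∑ i, y i), G (k.insertNth t y) := by
  have hmp := (volume_preserving_piFinSuccAbove (fun _ : Fin (n + 1) => ℝ) k).symm
  rw [← integral_indicator (Sx_meas _), ← integral_indicator (Sx_meas _)]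
  rw [← hmp.integral_comp']
  have hInt : Integrable ((Sx (n + 1)).indicator G) := by
    rw [integrable_indicator_iff (Sx_meas _)]
    exact hG.continuousOn.integrableOn_compact (Sx_compact _)
  have hInt2 := hmp.integrable_comp_of_integrable hInt
  rw [Measure.volume_eq_prod] at hInt2 ⊢
  rw [← integral_prod_swap]
  refine (integral_prod _ hInt2.swap).trans ?_
  refine integral_congr_ae (Filter.Eventually.of_forall fun y => ?_)
  have hmem : ∀ t : ℝ, k.insertNth (α := fun _ => ℝ) t y ∈ Sx (n + 1) ↔
      (0 ≤ t ∧ t ≤ 1 - ∑ i, y i) ∧ ∀ i, 0 ≤ y i := by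
    intro t
    simp only [Sx, Set.mem_ofPred_eq, Fin.sum_univ_succAbove _ k, k.forall_iff_succAbove,
      Fin.insertNth_apply_same, Fin.insertNth_apply_succAbove]
    constructor
    · rintro ⟨⟨h1, h2⟩, h3⟩; exact ⟨⟨h1, by linarith⟩, h2⟩
    · rintro ⟨⟨h1, h2⟩, h3⟩; exact ⟨⟨h1, h3⟩, by linarith⟩
  change ∫ t, (Sx (n + 1)).indicator G (k.insertNth t y) = _
  by_cases hy : y ∈ Sx n
  · rw [Set.indicator_of_mem hy, intervalIntegral.integral_of_le (by linarith [hy.2]),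
      ← integral_Icc_eq_integral_Ioc, ← integral_indicator measurableSet_Icc]
    refine integral_congr_ae (Filter.Eventually.of_forall fun t => ?_)
    by_cases ht : t ∈ Set.Icc 0 (1 - ∑ i, y i)
    · simp only [Set.indicator_of_mem ht]
      rw [Set.indicator_of_mem ((hmem t).2 ⟨ht, hy.1⟩)]
    · simp only [Set.indicator_of_notMem ht]
      rw [Set.indicator_of_notMem]
      exact fun h => ht ((hmem t).1 h).1
  · rw [Set.indicator_of_notMem hy]
    have : ∀ t : ℝ, (Sx (n + 1)).indicator G (k.insertNth t y) = 0 := by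
      intro t
      rw [Set.indicator_of_notMem]
      intro h
      have := (hmem t).1 h
      exact hy ⟨this.2, by linarith [this.1.1, this.1.2]⟩
    simp [this]

lemma integral_Sx_one (G : ℝ → ℝ) (hG : Continuous G) :
    ∫ y in Sx 1, G (y 0) = ∫ t in (0 : ℝ)..1, G t := by
  rw [Sx_fubini 0 (fun y => G (y 0)) (by fun_prop)]
  have : Sx 0 = Set.univ := by ext; simp [Sx]
  rw [this]
  simp [Measure.volume_pi_eq_dirac (0 : Fin 0 → ℝ)]

lemma beta_nat (a b : ℕ) :
    ∫ t in (0 : ℝ)..1, t ^ a * (1 - t) ^ b = (a.factorial * b.factorial : ℝ) / (a + b + 1).factorial := by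
  induction b generalizing a with
  | zero => simp [Nat.factorial_succ]; field_simp
  | succ b ih =>
    have h := intervalIntegral.integral_mul_deriv_eq_deriv_mul (a := (0 : ℝ)) (b := 1)
      (u := fun t => (1 - t) ^ (b + 1)) (v := fun t => t ^ (a + 1) / (a + 1))
      (u' := fun t => -((b + 1) * (1 - t) ^ b)) (v' := fun t => t ^ a)
      (fun t _ => by
        have := ((hasDerivAt_id t).const_sub 1).pow (b + 1)
        simp at this; exact this)
      (fun t _ => by
        have := (hasDerivAt_pow (a + 1) t).div_const ((a : ℝ) + 1)
        convert this using 1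
        have : (a : ℝ) + 1 ≠ 0 := by positivity
        push_cast; field_simp)
      (Continuous.intervalIntegrable (by fun_prop) _ _)
      (Continuous.intervalIntegrable (by fun_prop) _ _)
    have e1 : ∀ t : ℝ, t ^ a * (1 - t) ^ (b + 1) = (1 - t) ^ (b + 1) * t ^ a := fun t => mul_comm _ _
    have e2 : ∀ t : ℝ, -((b + 1) * (1 - t) ^ b) * (t ^ (a + 1) / (a + 1)) =
      (-((b + 1) / (a + 1)) : ℝ) * (t ^ (a + 1) * (1 - t) ^ b) := by intro t; field_simp
    simp only [e1, h, e2]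
    rw [intervalIntegral.integral_const_mul, ih]
    have h3 : a + 1 + b + 1 = a + (b + 1) + 1 := by ring
    rw [h3, Nat.factorial_succ a, Nat.factorial_succ b]
    push_cast
    have : (a : ℝ) + 1 ≠ 0 := by positivity
    simp
    field_simp

lemma moment (a b : ℕ) :
    ∫ y in Sx 2, y 0 ^ a * y 1 ^ b = (a.factorial * b.factorial : ℝ) / (a + b + 2).factorial := by
  rw [Sx_fubini 1 (fun y : Fin 2 → ℝ => y 0 ^ a * y 1 ^ b) (by fun_prop)]
  have : ∀ y : Fin 1 → ℝ, (∫ t in (0 : ℝ)..(1 - ∑ i, y i),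
      (Fin.insertNth (α := fun _ => ℝ) 1 t y : Fin 2 → ℝ) 0 ^ a *
      (Fin.insertNth (α := fun _ => ℝ) 1 t y : Fin 2 → ℝ) 1 ^ b) =
      (fun r : ℝ => (1 / (b + 1) : ℝ) * (r ^ a * (1 - r) ^ (b + 1))) (y 0) := by
    intro y
    have h0 : ∀ t : ℝ, (Fin.insertNth (α := fun _ => ℝ) 1 t y : Fin 2 → ℝ) 0 = y 0 := by
      intro t
      exact Fin.insertNth_apply_succAbove (α := fun _ => ℝ) (1 : Fin 2) t y 0
    simp only [h0, Fin.insertNth_apply_same]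
    rw [intervalIntegral.integral_const_mul, integral_pow]
    simp
    field_simp
  simp only [this]
  rw [integral_Sx_one (fun r : ℝ => (1 / (b + 1) : ℝ) * (r ^ a * (1 - r) ^ (b + 1))) (by fun_prop),
    intervalIntegral.integral_const_mul, beta_nat, Nat.factorial_succ b]
  push_cast
  have : a + (b + 1) + 1 = a + b + 2 := by ring
  rw [this]
  field_simp

/-- Polynomials in three variables. -/
abbrev PA := MvPolynomial (Fin 3) ℝ

lemma evalP_cont (p : PA) : Continuous (fun x : E3 => evalP x p) := by
  unfold evalP
  exact (MvPolynomial.continuous_eval p).comp (by fun_prop)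

lemma evalP_ph_cont {n : ℕ} (b : Fin (n + 1) → E3) (p : PA) :
    Continuous (fun y => evalP (ph b y) p) := (evalP_cont p).comp (ph_cont b)

@[simp] lemma evalP_add (x : E3) (p q : PA) : evalP x (p + q) = evalP x p + evalP x q := by
  simp [evalP]
@[simp] lemma evalP_sub (x : E3) (p q : PA) : evalP x (p - q) = evalP x p - evalP x q := by
  simp [evalP]
@[simp] lemma evalP_mul (x : E3) (p q : PA) : evalP x (p * q) = evalP x p * evalP x q := by
  simp [evalP]
@[simp] lemma evalP_pow (x : E3) (p : PA) (n : ℕ) : evalP x (p ^ n) = evalP x p ^ n := by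
  simp [evalP]
@[simp] lemma evalP_smul (x : E3) (c : ℝ) (p : PA) : evalP x (c • p) = c * evalP x p := by
  simp [evalP]
@[simp] lemma evalP_C (x : E3) (c : ℝ) : evalP x (C c) = c := by simp [evalP]
@[simp] lemma evalP_zero (x : E3) : evalP x 0 = 0 := by simp [evalP]
@[simp] lemma evalP_one (x : E3) : evalP x 1 = 1 := by simp [evalP]
@[simp] lemma evalP_neg (x : E3) (p : PA) : evalP x (-p) = - evalP x p := by simp [evalP]
@[simp] lemma evalP_X (x : E3) (k : Fin 3) : evalP x (X k) = x k := by simp [evalP]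
@[simp] lemma evalP_ofNat (x : E3) (n : ℕ) [n.AtLeastTwo] :
    evalP x (OfNat.ofNat n : PA) = OfNat.ofNat n := by simp [evalP]
@[simp] lemma evalP_sum {ι : Type*} (x : E3) (s : Finset ι) (p : ι → PA) :
    evalP x (∑ i ∈ s, p i) = ∑ i ∈ s, evalP x (p i) := by simp [evalP]

/-- Directional derivative along the edge from vertex `0` to vertex `j + 1`. -/
def Dd (a : Fin 4 → E3) (j : Fin 3) : Derivation ℝ PA PA :=
  ∑ k, (a j.succ k - a 0 k) • pderiv k

lemma Dd_apply (a : Fin 4 → E3) (j : Fin 3) (v : PA) :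
    Dd a j v = ∑ k, (a j.succ k - a 0 k) • pderiv k v := by
  simp [Dd, Fin.sum_univ_three]

lemma hasDerivAt_eval (p u : Fin 3 → ℝ) (v : PA) (t : ℝ) :
    HasDerivAt (fun t : ℝ => MvPolynomial.eval (fun k => p k + t * u k) v)
      (∑ k, u k * MvPolynomial.eval (fun k => p k + t * u k) (pderiv k v)) t := by
  induction v using MvPolynomial.induction_on with
  | C c => simpa using hasDerivAt_const t c
  | add f g hf hg =>
    simp only [map_add, mul_add, Finset.sum_add_distrib]
    exact hf.add hg
  | mul_X f i hf =>
    have h1 : HasDerivAt (fun t : ℝ => p i + t * u i) (u i) t := by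
      simpa using ((hasDerivAt_id t).mul_const (u i)).const_add (p i)
    have := hf.mul h1
    simp only [Derivation.leibniz, smul_eq_mul, pderiv_X, map_add, map_mul, eval_X]
    refine this.congr_deriv ?_
    symm
    simp only [mul_add, Finset.sum_add_distrib, Finset.sum_mul]
    rw [add_comm]
    congr 1
    · rw [← Finset.sum_add_distrib]
      exact Finset.sum_congr rfl fun k _ => by ring
    · rw [Finset.sum_eq_single i]
      · simp; ring
      · intro k _ hk
        simp [hk]
      · simp

lemma ph_insert (a : Fin 4 → E3) (j : Fin 3) (t : ℝ) (y : Fin 2 → ℝ) (k : Fin 3) :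
    ph a (j.insertNth t y) k =
      (a 0 k + ∑ m, y m * (a (j.succAbove m).succ k - a 0 k)) + t * (a j.succ k - a 0 k) := by
  rw [ph_apply, Fin.sum_univ_succAbove _ j]
  simp only [Fin.insertNth_apply_same, Fin.insertNth_apply_succAbove]
  ring

lemma div_ref (a : Fin 4 → E3) (ha : AffineIndependent ℝ a) (v : PA)
    (hv : ∀ i, ∫ x in face a i, evalP x v ∂(μH[2]) = 0) (j : Fin 3) :
    ∫ y in Sx 3, evalP (ph a y) (Dd a j v) = 0 := by
  rw [Sx_fubini j _ (evalP_ph_cont a _)]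
  have hF : ∀ y : Fin 2 → ℝ, (∫ t in (0 : ℝ)..(1 - ∑ i, y i),
      evalP (ph a (j.insertNth t y)) (Dd a j v)) =
      evalP (ph a (j.insertNth (1 - ∑ i, y i) y)) v - evalP (ph a (j.insertNth 0 y)) v := by
    intro y
    refine intervalIntegral.integral_eq_sub_of_hasDerivAt
      (f := fun t => evalP (ph a (j.insertNth t y)) v) (fun t _ => ?_) ?_
    · have := hasDerivAt_eval (fun k => a 0 k + ∑ m, y m * (a (j.succAbove m).succ k - a 0 k))
        (fun k => a j.succ k - a 0 k) v t
      simp only [← ph_insert] at this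
      refine HasDerivAt.congr_deriv this ?_
      rw [Dd_apply]
      simp [evalP]
    · refine Continuous.intervalIntegrable ((evalP_ph_cont a _).comp ?_) _ _
      fun_prop
  simp only [hF]
  -- the two faces
  have h0 : ∫ y in Sx 2, evalP (ph a (j.insertNth 0 y)) v = 0 := by
    obtain ⟨c, hc, h⟩ := face_int a ha j.succ (j.succ.succAbove) Fin.succAbove_right_injective
      (fun m => Fin.succAbove_ne _ _)
    have := (h fun x => evalP x v).symm.trans (hv _)
    rw [mul_eq_zero, or_iff_right hc] at this
    refine Eq.trans ?_ this
    congr 1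
    ext y
    congr 1
    ext k
    rw [ph_insert, ph_apply]
    simp
  have h1 : ∫ y in Sx 2, evalP (ph a (j.insertNth (1 - ∑ i, y i) y)) v = 0 := by
    obtain ⟨c, hc, h⟩ := face_int a ha 0 (Fin.cons j.succ fun m => (j.succAbove m).succ)
      (by
        rw [Fin.cons_injective_iff]
        refine ⟨?_, fun m n h => ?_⟩
        · rintro ⟨m, hm⟩
          exact Fin.succAbove_ne j m (Fin.succ_injective _ hm)
        · exact Fin.succAbove_right_injective (Fin.succ_injective _ h))
      (fun m => by
        refine Fin.cases ?_ (fun m => ?_) m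
        · exact Fin.succ_ne_zero _
        · exact Fin.succ_ne_zero _)
    have := (h fun x => evalP x v).symm.trans (hv _)
    rw [mul_eq_zero, or_iff_right hc] at this
    refine Eq.trans ?_ this
    congr 1
    ext y
    congr 1
    ext k
    rw [ph_insert, ph_apply]
    simp [Fin.sum_univ_two]
    ring
  rw [integral_sub, h0, h1, sub_zero]
  · refine ContinuousOn.integrableOn_compact (Sx_compact _) (Continuous.continuousOn ?_)
    refine (evalP_ph_cont a _).comp ?_
    fun_prop
  · refine ContinuousOn.integrableOn_compact (Sx_compact _) (Continuous.continuousOn ?_)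
    refine (evalP_ph_cont a _).comp ?_
    fun_prop

lemma exists_bary (a : Fin 4 → E3) (ha : AffineIndependent ℝ a) :
    ∃ lam : Fin 4 → PA, (∀ m, (lam m).totalDegree ≤ 1) ∧ (∑ m, lam m = 1) ∧
      (∀ i m, evalP (a i) (lam m) = if i = m then 1 else 0) ∧
      (∀ m, ∃ (c : ℝ) (g : Fin 3 → ℝ), ∀ x, evalP x (lam m) = c + ∑ k, g k * x k) ∧
      (∀ i j : Fin 3, Dd a i (lam j.succ) = if i = j then 1 else 0) ∧
      (∀ k, (X k : PA) = C (a 0 k) + ∑ j : Fin 3, C (a j.succ k - a 0 k) * lam j.succ) ∧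
      ∃ β : Fin 3 → Fin 3 → ℝ, ∀ k v, pderiv k v = ∑ j, β k j • Dd a j v := by
  set U : Matrix (Fin 3) (Fin 3) ℝ := Matrix.of fun i k => a i.succ k - a 0 k with hU
  have hunit : IsUnit U := by
    rw [← Matrix.linearIndependent_rows_iff_isUnit]
    rw [Fintype.linearIndependent_iff]
    intro g hg
    have hz : phL a (WithLp.toLp 2 g) = phL a 0 := by
      rw [map_zero]
      ext k
      have := congrFun hg k
      simpa [phL, hU, Matrix.row] using this
    have := phL_inj a ha hz
    intro i
    have h2 := congrArg (fun w : EuclideanSpace ℝ (Fin 3) => w i) this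
    simpa using h2
  have hdet : IsUnit U.det := (Matrix.isUnit_iff_isUnit_det U).1 hunit
  have hUβ := Matrix.mul_nonsing_inv U hdet
  have hβU := Matrix.nonsing_inv_mul U hdet
  set β := U⁻¹ with hβ
  have hUβ' : ∀ i j, ∑ k, (a i.succ k - a 0 k) * β k j = if i = j then 1 else 0 := by
    intro i j
    have := congrFun (congrFun hUβ i) j
    simpa [Matrix.mul_apply, Matrix.one_apply, hU] using this
  have hβU' : ∀ k l, ∑ j, β k j * (a j.succ l - a 0 l) = if k = l then 1 else 0 := by
    intro i j
    have := congrFun (congrFun hβU i) j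
    simpa [Matrix.mul_apply, Matrix.one_apply, hU] using this
  let ell : Fin 3 → PA := fun j => ∑ k, C (β k j) * (X k - C (a 0 k))
  have ell_deg : ∀ j, (ell j).totalDegree ≤ 1 := by
    intro j
    refine totalDegree_finsetSum_le fun k _ => ?_
    refine (totalDegree_mul _ _).trans ?_
    rw [totalDegree_C, zero_add]
    refine (totalDegree_sub _ _).trans ?_
    simp
  have ell_eval : ∀ j x, evalP x (ell j) = ∑ k, β k j * (x k - a 0 k) := by
    intro j x; simp [ell]
  have ell_a : ∀ i j : Fin 3, evalP (a i.succ) (ell j) = if i = j then 1 else 0 := by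
    intro i j
    rw [ell_eval, ← hUβ']
    exact Finset.sum_congr rfl fun k _ => mul_comm _ _
  have ell_a0 : ∀ j : Fin 3, evalP (a 0) (ell j) = 0 := by
    intro j
    rw [ell_eval]; simp
  refine ⟨Fin.cons (1 - ∑ j, ell j) ell, ?_, ?_, ?_, ?_, ?_, ?_, β, ?_⟩
  · intro m
    refine Fin.cases ?_ (fun j => ell_deg j) m
    rw [Fin.cons_zero]
    refine (totalDegree_sub _ _).trans (max_le (by simp) ?_)
    exact totalDegree_finsetSum_le fun j _ => ell_deg j
  · rw [Fin.sum_univ_succ]; simp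
  · intro i m
    refine Fin.cases ?_ (fun i => ?_) i <;> refine Fin.cases ?_ (fun m => ?_) m
    · simp [ell_a0]
    · simp only [Fin.cons_succ, ell_a0]
      rw [if_neg (Fin.succ_ne_zero m).symm]
    · simp [ell_a]
    · simp only [Fin.cons_succ, ell_a, Fin.succ_inj]
  · have h : ∀ j, ∃ (c : ℝ) (g : Fin 3 → ℝ), ∀ x, evalP x (ell j) = c + ∑ k, g k * x k := by
      intro j
      refine ⟨- ∑ k, β k j * a 0 k, fun k => β k j, fun x => ?_⟩
      rw [ell_eval]
      simp only [mul_sub, Finset.sum_sub_distrib]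
      ring
    intro m
    refine Fin.cases ?_ (fun j => h j) m
    choose c g hcg using h
    refine ⟨1 - ∑ j, c j, fun k => - ∑ j, g j k, fun x => ?_⟩
    simp only [Fin.cons_zero, evalP_sub, evalP_one, evalP_sum, hcg]
    simp only [Fin.sum_univ_three]
    ring
  · intro i j
    rw [Fin.cons_succ, Dd_apply]
    have : ∀ k, pderiv k (ell j) = C (β k j) := by
      intro k
      simp only [ell, map_sum, Derivation.leibniz, map_sub, pderiv_C, pderiv_X]
      rw [Finset.sum_eq_single k]
      · simp
      · intro l _ hl; simp [hl]
      · simp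
    simp only [this, smul_eq_C_mul, ← C_mul, ← map_sum]
    rw [hUβ']
    split_ifs <;> simp
  · intro k
    simp only [Fin.cons_succ, ell]
    apply MvPolynomial.funext
    intro x
    simp only [map_add, map_sum, map_mul, map_sub, eval_C, eval_X]
    simp only [Finset.mul_sum]
    rw [Finset.sum_comm]
    have : ∀ l, ∑ j : Fin 3, (a j.succ k - a 0 k) * (β l j * (x l - a 0 l)) =
        (if l = k then 1 else 0) * (x l - a 0 l) := by
      intro l
      rw [← hβU', Finset.sum_mul]
      exact Finset.sum_congr rfl fun j _ => by ring
    simp [this]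
  · intro k v
    simp only [Dd_apply, Finset.smul_sum, smul_smul]
    rw [Finset.sum_comm]
    simp only [← Finset.sum_smul, hβU']
    simp

/-- Univariate bubble-type generator. -/
def pf {A : Type*} [CommRing A] (x : A) : A := 14 * x ^ 4 - 21 * x ^ 3 + 9 * x ^ 2 - x
/-- Generator attached to an edge. -/
def pg {A : Type*} [CommRing A] (x y : A) : A :=
  1 - 15 * (x + y) + 45 * (x ^ 2 + y ^ 2) + 180 * (x * y) - 35 * (x ^ 3 + y ^ 3)
    - 420 * (x ^ 2 * y + x * y ^ 2) + 280 * (x ^ 3 * y + x * y ^ 3) + 420 * (x ^ 2 * y ^ 2)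
/-- Generator attached to a vertex. -/
def pF {A : Type*} [CommRing A] (x y z w : A) : A :=
  42 * (x - 4 * x ^ 2) * (y * z + y * w + z * w) - 5 * x + 24 * x ^ 2 - 21 * x ^ 3

lemma der_pf (D : Derivation ℝ PA PA) (x : PA) :
    D (pf x) = (56 * x ^ 3 - 63 * x ^ 2 + 18 * x - 1) * D x := by
  have h : ∀ n : ℕ, D (n : PA) = 0 := fun n => D.map_natCast n
  have h14 := h 14; have h21 := h 21; have h9 := h 9
  push_cast at h14 h21 h9
  simp only [pf, map_sub, map_add, Derivation.leibniz, Derivation.leibniz_pow, smul_eq_mul, h14,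
    h21, h9]
  simp only [nsmul_eq_mul]
  push_cast
  ring

lemma der_pg (D : Derivation ℝ PA PA) (x y : PA) :
    D (pg x y) =
      (-15 + 90 * x + 180 * y - 105 * x ^ 2 - 840 * x * y - 420 * y ^ 2 + 840 * x ^ 2 * y
        + 280 * y ^ 3 + 840 * x * y ^ 2) * D x +
      (-15 + 90 * y + 180 * x - 105 * y ^ 2 - 840 * x * y - 420 * x ^ 2 + 840 * y ^ 2 * x
        + 280 * x ^ 3 + 840 * y * x ^ 2) * D y := by
  have h : ∀ n : ℕ, D (n : PA) = 0 := fun n => D.map_natCast n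
  have h15 := h 15; have h45 := h 45; have h180 := h 180; have h35 := h 35
  have h420 := h 420; have h280 := h 280
  push_cast at h15 h45 h180 h35 h420 h280
  simp only [pg, map_sub, map_add, Derivation.leibniz, Derivation.leibniz_pow, smul_eq_mul, h15,
    h45, h180, h35, h420, h280, Derivation.map_one_eq_zero]
  simp only [nsmul_eq_mul]
  push_cast
  ring

lemma der_pF (D : Derivation ℝ PA PA) (x y z w : PA) :
    D (pF x y z w) =
      (42 * (1 - 8 * x) * (y * z + y * w + z * w) - 5 + 48 * x - 63 * x ^ 2) * D x +
      42 * (x - 4 * x ^ 2) * ((z + w) * D y + (y + w) * D z + (y + z) * D w) := by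
  have h : ∀ n : ℕ, D (n : PA) = 0 := fun n => D.map_natCast n
  have h42 := h 42; have h4 := h 4; have h5 := h 5; have h24 := h 24; have h21 := h 21
  push_cast at h42 h4 h5 h24 h21
  simp only [pF, map_sub, map_add, Derivation.leibniz, Derivation.leibniz_pow, smul_eq_mul, h42,
    h4, h5, h24, h21]
  simp only [nsmul_eq_mul]
  push_cast
  ring

lemma der_pb (D : Derivation ℝ PA PA) (x y z w : PA) :
    D (x * y * z * w) = y * z * w * D x + x * z * w * D y + x * y * w * D z + x * y * z * D w := by
  simp only [Derivation.leibniz, smul_eq_mul]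
  ring

lemma mem_of_nat_smul (R : Submodule ℝ PA) (n : ℝ) (hn : n ≠ 0) (p : PA) (h : n • p ∈ R) :
    p ∈ R := by
  have := R.smul_mem n⁻¹ h
  rwa [smul_smul, inv_mul_cancel₀ hn, one_smul] at this

set_option maxHeartbeats 2000000 in
lemma key_mem (R S : Submodule ℝ PA) (D1 D2 D3 : Derivation ℝ PA PA) (x y z w : PA)
    (hw : w = 1 - x - y - z)
    (d1x : D1 x = 1) (d1y : D1 y = 0) (d1z : D1 z = 0)
    (d2x : D2 x = 0) (d2y : D2 y = 1) (d2z : D2 z = 0)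
    (d3x : D3 x = 0) (d3y : D3 y = 0) (d3z : D3 z = 1)
    (hD1 : ∀ {s}, s ∈ S → D1 s ∈ R) (hD2 : ∀ {s}, s ∈ S → D2 s ∈ R)
    (hD3 : ∀ {s}, s ∈ S → D3 s ∈ R) (h1 : (1 : PA) ∈ R)
    (hfx : pf x ∈ S) (hfy : pf y ∈ S) (hfz : pf z ∈ S)
    (hFx : pF x y z w ∈ S) (hFy : pF y x z w ∈ S) (hFz : pF z x y w ∈ S) (hFw : pF w x y z ∈ S)
    (hgxy : pg x y ∈ S) (hgxz : pg x z ∈ S) (hgxw : pg x w ∈ S) (hgyz : pg y z ∈ S)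
    (hgyw : pg y w ∈ S) (hgzw : pg z w ∈ S) (hb : x * y * z * w ∈ S) :
    x ∈ R ∧ x ^ 2 ∈ R ∧ x * y ∈ R ∧ x ^ 3 ∈ R ∧ x ^ 2 * y ∈ R ∧ x * y * z ∈ R := by
  have d1w : D1 w = -1 := by rw [hw]; simp [d1x, d1y, d1z]
  have d2w : D2 w = -1 := by rw [hw]; simp [d2x, d2y, d2z]
  have d3w : D3 w = -1 := by rw [hw]; simp [d3x, d3y, d3z]
  refine ⟨?_, ?_, ?_, ?_, ?_, ?_⟩
  · have e : (120 : ℝ) • (x) =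
      (10 : ℝ) • D1 (pF x y z w) + (-3360 : ℝ) • D1 (x * y * z * w) + (20 : ℝ) • D1 (pf x) +
      (2 : ℝ) • D1 (pg z w) + (-5 : ℝ) • D2 (pF x y z w) + (-5 : ℝ) • D2 (pF y x z w) +
      (840 : ℝ) • D2 (x * y * z * w) + (3 : ℝ) • D2 (pg y z) + (-5 : ℝ) • D3 (pF x y z w) +
      (-5 : ℝ) • D3 (pF z x y w) + (840 : ℝ) • D3 (x * y * z * w) + (-5 : ℝ) • D3 (pf z) +
      (2 : ℝ) • D3 (pg x z) + (30 : ℝ) • 1 := by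
      simp only [der_pf, der_pg, der_pF, der_pb, d1x, d1y, d1z, d1w, d2x, d2y, d2z, d2w, d3x, d3y,
        d3z, d3w, smul_eq_C_mul, map_neg, map_ofNat]
      rw [hw]
      ring
    refine mem_of_nat_smul R 120 (by norm_num) _ ?_
    rw [e]
    exact R.add_mem (R.add_mem (R.add_mem (R.add_mem (R.add_mem (R.add_mem (R.add_mem (R.add_mem (R.add_mem (R.add_mem (R.add_mem (R.add_mem (R.add_mem (R.smul_mem _ (hD1 hFx))
      (R.smul_mem _ (hD1 hb)))
      (R.smul_mem _ (hD1 hfx)))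
      (R.smul_mem _ (hD1 hgzw)))
      (R.smul_mem _ (hD2 hFx)))
      (R.smul_mem _ (hD2 hFy)))
      (R.smul_mem _ (hD2 hb)))
      (R.smul_mem _ (hD2 hgyz)))
      (R.smul_mem _ (hD3 hFx)))
      (R.smul_mem _ (hD3 hFz)))
      (R.smul_mem _ (hD3 hb)))
      (R.smul_mem _ (hD3 hfz)))
      (R.smul_mem _ (hD3 hgxz)))
      (R.smul_mem _ (h1))
  · have e : (2100 : ℝ) • (x ^ 2) =
      (170 : ℝ) • D1 (pF x y z w) + (-36960 : ℝ) • D1 (x * y * z * w) + (570 : ℝ) • D1 (pf x) +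
      (10 : ℝ) • D1 (pg x y) + (10 : ℝ) • D1 (pg y w) + (-75 : ℝ) • D2 (pF x y z w) +
      (-55 : ℝ) • D2 (pF y x z w) + (9240 : ℝ) • D2 (x * y * z * w) + (-105 : ℝ) • D2 (pf y) +
      (24 : ℝ) • D2 (pg x w) + (-75 : ℝ) • D3 (pF x y z w) + (-55 : ℝ) • D3 (pF z x y w) +
      (9240 : ℝ) • D3 (x * y * z * w) + (21 : ℝ) • D3 (pg y z) + (210 : ℝ) • 1 := by
      simp only [der_pf, der_pg, der_pF, der_pb, d1x, d1y, d1z, d1w, d2x, d2y, d2z, d2w, d3x, d3y,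
        d3z, d3w, smul_eq_C_mul, map_neg, map_ofNat]
      rw [hw]
      ring
    refine mem_of_nat_smul R 2100 (by norm_num) _ ?_
    rw [e]
    exact R.add_mem (R.add_mem (R.add_mem (R.add_mem (R.add_mem (R.add_mem (R.add_mem (R.add_mem (R.add_mem (R.add_mem (R.add_mem (R.add_mem (R.add_mem (R.add_mem (R.smul_mem _ (hD1 hFx))
      (R.smul_mem _ (hD1 hb)))
      (R.smul_mem _ (hD1 hfx)))
      (R.smul_mem _ (hD1 hgxy)))
      (R.smul_mem _ (hD1 hgyw)))
      (R.smul_mem _ (hD2 hFx)))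
      (R.smul_mem _ (hD2 hFy)))
      (R.smul_mem _ (hD2 hb)))
      (R.smul_mem _ (hD2 hfy)))
      (R.smul_mem _ (hD2 hgxw)))
      (R.smul_mem _ (hD3 hFx)))
      (R.smul_mem _ (hD3 hFz)))
      (R.smul_mem _ (hD3 hb)))
      (R.smul_mem _ (hD3 hgyz)))
      (R.smul_mem _ (h1))
  · have e : (8400 : ℝ) • (x * y) =
      (15 : ℝ) • D1 (pF x y z w) + (25 : ℝ) • D1 (pF y x z w) + (-27720 : ℝ) • D1 (x * y * z * w) +
      (-185 : ℝ) • D1 (pf x) + (25 : ℝ) • D2 (pF x y z w) + (15 : ℝ) • D2 (pF y x z w) +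
      (-27720 : ℝ) • D2 (x * y * z * w) + (15 : ℝ) • D2 (pf y) + (-47 : ℝ) • D2 (pg x w) +
      (40 : ℝ) • D2 (pg x y) + (75 : ℝ) • D3 (pF w x y z) + (-35 : ℝ) • D3 (pF z x y w) +
      (31080 : ℝ) • D3 (x * y * z * w) + (-20 : ℝ) • D3 (pg x z) + (27 : ℝ) • D3 (pg y z) +
      (420 : ℝ) • 1 := by
      simp only [der_pf, der_pg, der_pF, der_pb, d1x, d1y, d1z, d1w, d2x, d2y, d2z, d2w, d3x, d3y,
        d3z, d3w, smul_eq_C_mul, map_neg, map_ofNat]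
      rw [hw]
      ring
    refine mem_of_nat_smul R 8400 (by norm_num) _ ?_
    rw [e]
    exact R.add_mem (R.add_mem (R.add_mem (R.add_mem (R.add_mem (R.add_mem (R.add_mem (R.add_mem (R.add_mem (R.add_mem (R.add_mem (R.add_mem (R.add_mem (R.add_mem (R.add_mem (R.smul_mem _ (hD1 hFx))
      (R.smul_mem _ (hD1 hFy)))
      (R.smul_mem _ (hD1 hb)))
      (R.smul_mem _ (hD1 hfx)))
      (R.smul_mem _ (hD2 hFx)))
      (R.smul_mem _ (hD2 hFy)))
      (R.smul_mem _ (hD2 hb)))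
      (R.smul_mem _ (hD2 hfy)))
      (R.smul_mem _ (hD2 hgxw)))
      (R.smul_mem _ (hD2 hgxy)))
      (R.smul_mem _ (hD3 hFw)))
      (R.smul_mem _ (hD3 hFz)))
      (R.smul_mem _ (hD3 hb)))
      (R.smul_mem _ (hD3 hgxz)))
      (R.smul_mem _ (hD3 hgyz)))
      (R.smul_mem _ (h1))
  · have e : (2800 : ℝ) • (x ^ 3) =
      (180 : ℝ) • D1 (pF x y z w) + (-30240 : ℝ) • D1 (x * y * z * w) + (680 : ℝ) • D1 (pf x) +
      (-75 : ℝ) • D2 (pF x y z w) + (-45 : ℝ) • D2 (pF y x z w) + (7560 : ℝ) • D2 (x * y * z * w) +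
      (36 : ℝ) • D2 (pg x w) + (9 : ℝ) • D2 (pg y z) + (-75 : ℝ) • D3 (pF x y z w) +
      (-45 : ℝ) • D3 (pF z x y w) + (7560 : ℝ) • D3 (x * y * z * w) + (-45 : ℝ) • D3 (pf z) +
      (140 : ℝ) • 1 := by
      simp only [der_pf, der_pg, der_pF, der_pb, d1x, d1y, d1z, d1w, d2x, d2y, d2z, d2w, d3x, d3y,
        d3z, d3w, smul_eq_C_mul, map_neg, map_ofNat]
      rw [hw]
      ring
    refine mem_of_nat_smul R 2800 (by norm_num) _ ?_
    rw [e]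
    exact R.add_mem (R.add_mem (R.add_mem (R.add_mem (R.add_mem (R.add_mem (R.add_mem (R.add_mem (R.add_mem (R.add_mem (R.add_mem (R.add_mem (R.smul_mem _ (hD1 hFx))
      (R.smul_mem _ (hD1 hb)))
      (R.smul_mem _ (hD1 hfx)))
      (R.smul_mem _ (hD2 hFx)))
      (R.smul_mem _ (hD2 hFy)))
      (R.smul_mem _ (hD2 hb)))
      (R.smul_mem _ (hD2 hgxw)))
      (R.smul_mem _ (hD2 hgyz)))
      (R.smul_mem _ (hD3 hFx)))
      (R.smul_mem _ (hD3 hFz)))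
      (R.smul_mem _ (hD3 hb)))
      (R.smul_mem _ (hD3 hfz)))
      (R.smul_mem _ (h1))
  · have e : (33600 : ℝ) • (x ^ 2 * y) =
      (195 : ℝ) • D1 (pF x y z w) + (25 : ℝ) • D1 (pF y x z w) + (-74760 : ℝ) • D1 (x * y * z * w) +
      (40 : ℝ) • D1 (pf x) + (-11 : ℝ) • D1 (pg x y) + (75 : ℝ) • D2 (pF x y z w) +
      (-55 : ℝ) • D2 (pF y x z w) + (-15960 : ℝ) • D2 (x * y * z * w) + (-11 : ℝ) • D2 (pg x w) +
      (71 : ℝ) • D2 (pg x y) + (75 : ℝ) • D3 (pF w x y z) + (-150 : ℝ) • D3 (pF x y z w) +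
      (-105 : ℝ) • D3 (pF z x y w) + (42840 : ℝ) • D3 (x * y * z * w) + (41 : ℝ) • D3 (pg y z) +
      (560 : ℝ) • 1 := by
      simp only [der_pf, der_pg, der_pF, der_pb, d1x, d1y, d1z, d1w, d2x, d2y, d2z, d2w, d3x, d3y,
        d3z, d3w, smul_eq_C_mul, map_neg, map_ofNat]
      rw [hw]
      ring
    refine mem_of_nat_smul R 33600 (by norm_num) _ ?_
    rw [e]
    exact R.add_mem (R.add_mem (R.add_mem (R.add_mem (R.add_mem (R.add_mem (R.add_mem (R.add_mem (R.add_mem (R.add_mem (R.add_mem (R.add_mem (R.add_mem (R.add_mem (R.add_mem (R.smul_mem _ (hD1 hFx))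
      (R.smul_mem _ (hD1 hFy)))
      (R.smul_mem _ (hD1 hb)))
      (R.smul_mem _ (hD1 hfx)))
      (R.smul_mem _ (hD1 hgxy)))
      (R.smul_mem _ (hD2 hFx)))
      (R.smul_mem _ (hD2 hFy)))
      (R.smul_mem _ (hD2 hb)))
      (R.smul_mem _ (hD2 hgxw)))
      (R.smul_mem _ (hD2 hgxy)))
      (R.smul_mem _ (hD3 hFw)))
      (R.smul_mem _ (hD3 hFx)))
      (R.smul_mem _ (hD3 hFz)))
      (R.smul_mem _ (hD3 hb)))
      (R.smul_mem _ (hD3 hgyz)))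
      (R.smul_mem _ (h1))
  · have e : (8400 : ℝ) • (x * y * z) =
      (-10 : ℝ) • D1 (pF x y z w) + (-2520 : ℝ) • D1 (x * y * z * w) + (-35 : ℝ) • D1 (pf x) +
      (5 : ℝ) • D1 (pg x y) + (5 : ℝ) • D1 (pg y w) + (-10 : ℝ) • D2 (pF y x z w) +
      (-2520 : ℝ) • D2 (x * y * z * w) + (-60 : ℝ) • D2 (pf y) + (-7 : ℝ) • D2 (pg x w) +
      (-10 : ℝ) • D3 (pF z x y w) + (-2520 : ℝ) • D3 (x * y * z * w) + (12 : ℝ) • D3 (pg y z) +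
      (70 : ℝ) • 1 := by
      simp only [der_pf, der_pg, der_pF, der_pb, d1x, d1y, d1z, d1w, d2x, d2y, d2z, d2w, d3x, d3y,
        d3z, d3w, smul_eq_C_mul, map_neg, map_ofNat]
      rw [hw]
      ring
    refine mem_of_nat_smul R 8400 (by norm_num) _ ?_
    rw [e]
    exact R.add_mem (R.add_mem (R.add_mem (R.add_mem (R.add_mem (R.add_mem (R.add_mem (R.add_mem (R.add_mem (R.add_mem (R.add_mem (R.add_mem (R.smul_mem _ (hD1 hFx))
      (R.smul_mem _ (hD1 hb)))
      (R.smul_mem _ (hD1 hfx)))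
      (R.smul_mem _ (hD1 hgxy)))
      (R.smul_mem _ (hD1 hgyw)))
      (R.smul_mem _ (hD2 hFy)))
      (R.smul_mem _ (hD2 hb)))
      (R.smul_mem _ (hD2 hfy)))
      (R.smul_mem _ (hD2 hgxw)))
      (R.smul_mem _ (hD3 hFz)))
      (R.smul_mem _ (hD3 hb)))
      (R.smul_mem _ (hD3 hgyz)))
      (R.smul_mem _ (h1))

lemma deg_bind {n m : ℕ} (f : Fin n → MvPolynomial (Fin m) ℝ) (hf : ∀ i, (f i).totalDegree ≤ 1)
    (p : MvPolynomial (Fin n) ℝ) : (bind₁ f p).totalDegree ≤ p.totalDegree := by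
  rw [bind₁, aeval_def, eval₂_eq']
  refine totalDegree_finsetSum_le fun d hd => ?_
  have h1 : ∑ i, d i ≤ p.totalDegree := by
    have := le_totalDegree hd
    rwa [Finsupp.sum_fintype _ _ (by simp)] at this
  refine (totalDegree_mul _ _).trans ?_
  have h2 : (algebraMap ℝ (MvPolynomial (Fin m) ℝ) (coeff d p)).totalDegree = 0 :=
    totalDegree_C _
  rw [h2, zero_add]
  refine (totalDegree_finsetProd _ _).trans (le_trans (Finset.sum_le_sum fun i _ => ?_) h1)
  refine (totalDegree_pow _ _).trans ?_
  calc d i * (f i).totalDegree ≤ d i * 1 := Nat.mul_le_mul_left _ (hf i)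
    _ = d i := mul_one _

/-- Orthogonality to quadratic polynomials on the reference triangle. -/
def Orth (u : ℝ → ℝ → ℝ) : Prop :=
  Continuous (fun y : Fin 2 → ℝ => u (y 0) (y 1)) ∧
  ∀ r t : ℕ, r + t ≤ 2 → ∫ y in Sx 2, u (y 0) (y 1) * (y 0 ^ r * y 1 ^ t) = 0

lemma intOn {n : ℕ} {f : (Fin n → ℝ) → ℝ} (hf : Continuous f) : IntegrableOn f (Sx n) :=
  ContinuousOn.integrableOn_compact (Sx_compact _) hf.continuousOn

lemma orth_of_coeff (c : Fin 5 → Fin 5 → ℝ) (u : ℝ → ℝ → ℝ)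
    (hu : ∀ s t, u s t = ∑ i, ∑ j, c i j * (s ^ (i : ℕ) * t ^ (j : ℕ)))
    (h : ∀ r t : ℕ, r + t ≤ 2 → ∑ i : Fin 5, ∑ j : Fin 5,
      c i j * ((i + r).factorial * (j + t).factorial / (i + r + (j + t) + 2).factorial : ℝ) = 0) :
    Orth u := by
  obtain rfl : u = fun s t => ∑ i, ∑ j, c i j * (s ^ (i : ℕ) * t ^ (j : ℕ)) := by
    ext s t; exact hu s t
  refine ⟨by fun_prop, fun r t hrt => ?_⟩
  rw [← h r t hrt]
  simp only [Finset.sum_mul]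
  rw [integral_finsetSum _ fun i _ => intOn (by fun_prop)]
  refine Finset.sum_congr rfl fun i _ => ?_
  rw [integral_finsetSum _ fun i _ => intOn (by fun_prop)]
  refine Finset.sum_congr rfl fun j _ => ?_
  rw [← moment, ← integral_const_mul]
  congr 1
  ext y
  ring

lemma orth_zero : Orth (fun _ _ => 0) := ⟨by fun_prop, by simp⟩

lemma cases_le_two (P : ℕ → ℕ → Prop) (h00 : P 0 0) (h10 : P 1 0) (h01 : P 0 1) (h20 : P 2 0)
    (h11 : P 1 1) (h02 : P 0 2) (r t : ℕ) (h : r + t ≤ 2) : P r t := by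
  have hr : r ≤ 2 := by omega
  have ht : t ≤ 2 := by omega
  interval_cases r <;> interval_cases t <;> first | assumption | omega

lemma orth_pf : Orth (fun s _ => pf s) := by
  refine orth_of_coeff ![![0, 0, 0, 0, 0], ![-1, 0, 0, 0, 0], ![9, 0, 0, 0, 0],
    ![-21, 0, 0, 0, 0], ![14, 0, 0, 0, 0]] _ (fun s t => ?_) (cases_le_two _ ?_ ?_ ?_ ?_ ?_ ?_)
  · simp [Fin.sum_univ_five, pf]; ring
  all_goals simp [Fin.sum_univ_five, Nat.factorial]; try norm_num

lemma orth_pg : Orth (fun s t => pg s t) := by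
  refine orth_of_coeff ![![1, -15, 45, -35, 0], ![-15, 180, -420, 280, 0], ![45, -420, 420, 0, 0],
    ![-35, 280, 0, 0, 0], ![0, 0, 0, 0, 0]] _ (fun s t => ?_) (cases_le_two _ ?_ ?_ ?_ ?_ ?_ ?_)
  · simp [Fin.sum_univ_five, pg]; ring
  all_goals simp [Fin.sum_univ_five, Nat.factorial]; try norm_num

lemma orth_pg0 : Orth (fun s _ => pg s 0) := by
  refine orth_of_coeff ![![1, 0, 0, 0, 0], ![-15, 0, 0, 0, 0], ![45, 0, 0, 0, 0],
    ![-35, 0, 0, 0, 0], ![0, 0, 0, 0, 0]] _ (fun s t => ?_) (cases_le_two _ ?_ ?_ ?_ ?_ ?_ ?_)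
  · simp [Fin.sum_univ_five, pg]; ring
  all_goals simp [Fin.sum_univ_five, Nat.factorial]; try norm_num

lemma orth_pF : Orth (fun s t => pF s t (1 - s - t) 0) := by
  refine orth_of_coeff ![![0, 0, 0, 0, 0], ![-5, 42, -42, 0, 0], ![24, -210, 168, 0, 0],
    ![-21, 168, 0, 0, 0], ![0, 0, 0, 0, 0]] _ (fun s t => ?_) (cases_le_two _ ?_ ?_ ?_ ?_ ?_ ?_)
  · simp [Fin.sum_univ_five, pF]; ring
  all_goals simp [Fin.sum_univ_five, Nat.factorial]; try norm_num

lemma deg_aff {n : ℕ} (c : ℝ) (g : Fin n → ℝ) :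
    (C c + ∑ j, C (g j) * X j : MvPolynomial (Fin n) ℝ).totalDegree ≤ 1 := by
  refine (totalDegree_add _ _).trans (max_le (by simp) ?_)
  refine totalDegree_finsetSum_le fun j _ => (totalDegree_mul _ _).trans ?_
  simp

lemma orth_q (u : ℝ → ℝ → ℝ) (hu : Orth u) (b : Fin 3 → E3) (q : PA) (hq : q.totalDegree ≤ 2) :
    ∫ y in Sx 2, u (y 0) (y 1) * evalP (ph b y) q = 0 := by
  set Q := bind₁ (fun k => (C (b 0 k) + ∑ j : Fin 2, C (b j.succ k - b 0 k) * X j :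
    MvPolynomial (Fin 2) ℝ)) q with hQ
  have hQd : Q.totalDegree ≤ 2 := (deg_bind _ (fun k => deg_aff _ _) q).trans hq
  have hev : ∀ y, evalP (ph b y) q = eval y Q := by
    intro y
    rw [hQ, evalP, bind₁, ← coe_aeval_eq_eval, ← coe_aeval_eq_eval]
    simp only [RingHom.coe_coe]
    rw [← AlgHom.comp_apply, comp_aeval]
    congr 2
    ext k
    rw [ph_apply]
    simp [Fin.sum_univ_two]
    ring
  simp only [hev, eval_eq', Finset.mul_sum]
  rw [integral_finsetSum _ fun d _ => intOn (by exact hu.1.mul (by fun_prop))]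
  refine Finset.sum_eq_zero fun d hd => ?_
  have h1 : d 0 + d 1 ≤ 2 := by
    have := (le_totalDegree hd).trans hQd
    rwa [Finsupp.sum_fintype _ _ (by simp), Fin.sum_univ_two] at this
  have := hu.2 _ _ h1
  rw [← mul_zero (coeff d Q), ← this, ← integral_const_mul]
  congr 1
  ext y
  rw [Fin.prod_univ_two]
  ring

/-- Membership in the space of the statement. -/
def InB (a : Fin 4 → E3) (v : PA) : Prop := v.totalDegree ≤ 4 ∧
  ∀ (i : Fin 4) (q : PA), q.totalDegree ≤ 2 →
    ∫ x in face a i, evalP x v * evalP x q ∂(μH[2]) = 0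

lemma face_zero (a : Fin 4 → E3) (ha : AffineIndependent ℝ a) (i l m n : Fin 4) (hli : l ≠ i)
    (hmi : m ≠ i) (hni : n ≠ i) (hlm : l ≠ m) (hln : l ≠ n) (hmn : m ≠ n)
    (v : PA) (u : ℝ → ℝ → ℝ) (hu : Orth u)
    (h : ∀ y, evalP (ph (a ∘ ![l, m, n]) y) v = u (y 0) (y 1)) (q : PA) (hq : q.totalDegree ≤ 2) :
    ∫ x in face a i, evalP x v * evalP x q ∂(μH[2]) = 0 := by
  obtain ⟨c, hc, hi⟩ := face_int a ha i ![l, m, n]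
    (by
      intro x y hxy
      fin_cases x <;> fin_cases y <;> simp_all)
    (by
      intro x
      fin_cases x <;> simp_all)
  rw [hi]
  simp only [h]
  rw [orth_q u hu _ q hq, mul_zero]

/-- The subspace of the statement. -/
def B4 (a : Fin 4 → E3) (ha : AffineIndependent ℝ a) : Submodule ℝ PA where
  carrier := {v | InB a v}
  zero_mem' := ⟨by simp, fun i q hq => by simp⟩
  add_mem' := by
    rintro v w ⟨hv, hv'⟩ ⟨hw, hw'⟩
    refine ⟨(totalDegree_add _ _).trans (max_le hv hw), fun i q hq => ?_⟩
    obtain ⟨c, hc, hi⟩ := face_int a ha i i.succAbove Fin.succAbove_right_injective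
      (fun m => Fin.succAbove_ne _ _)
    have h1 := hv' i q hq
    have h2 := hw' i q hq
    rw [hi] at h1 h2 ⊢
    simp only [evalP_add, add_mul]
    rw [integral_add, mul_add, h1, h2, add_zero]
    · exact intOn ((evalP_ph_cont _ _).mul (evalP_ph_cont _ _))
    · exact intOn ((evalP_ph_cont _ _).mul (evalP_ph_cont _ _))
  smul_mem' := by
    rintro c v ⟨hv, hv'⟩
    refine ⟨(totalDegree_smul_le _ _).trans hv, fun i q hq => ?_⟩
    simp only [evalP_smul, mul_assoc]
    rw [integral_const_mul, hv' i q hq, mul_zero]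

lemma evalP_pf (x : E3) (p : PA) : evalP x (pf p) = pf (evalP x p) := by
  simp only [pf, evalP, map_add, map_sub, map_mul, map_pow, map_ofNat]
lemma evalP_pg (x : E3) (p q : PA) : evalP x (pg p q) = pg (evalP x p) (evalP x q) := by
  simp only [pg, evalP, map_add, map_sub, map_mul, map_pow, map_ofNat, map_one]
lemma evalP_pF (x : E3) (p q r s : PA) :
    evalP x (pF p q r s) = pF (evalP x p) (evalP x q) (evalP x r) (evalP x s) := by
  simp only [pF, evalP, map_add, map_sub, map_mul, map_pow, map_ofNat]

lemma lam_eval (a : Fin 4 → E3) (lam : Fin 4 → PA)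
    (h1 : ∀ i m, evalP (a i) (lam m) = if i = m then 1 else 0)
    (h2 : ∀ m, ∃ (c : ℝ) (g : Fin 3 → ℝ), ∀ x, evalP x (lam m) = c + ∑ k, g k * x k)
    (l m n k : Fin 4) (y : Fin 2 → ℝ) :
    evalP (ph (a ∘ ![l, m, n]) y) (lam k) = (if l = k then 1 else 0) * (1 - y 0 - y 1) +
      (if m = k then 1 else 0) * y 0 + (if n = k then 1 else 0) * y 1 := by
  obtain ⟨c, g, h⟩ := h2 k
  simp only [← h1, h, ph_apply]
  simp [Fin.sum_univ_two, Fin.sum_univ_three]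
  ring

lemma exists_fourth : ∀ i m n : Fin 4, ∃ l, l ≠ i ∧ l ≠ m ∧ l ≠ n := by decide
lemma exists_third : ∀ i m : Fin 4, m ≠ i → ∃ l n, l ≠ i ∧ n ≠ i ∧ l ≠ m ∧ l ≠ n ∧ m ≠ n := by
  decide

lemma dadd {k : ℕ} {p q : PA} (hp : p.totalDegree ≤ k) (hq : q.totalDegree ≤ k) :
    (p + q).totalDegree ≤ k := (totalDegree_add _ _).trans (max_le hp hq)
lemma dsub {k : ℕ} {p q : PA} (hp : p.totalDegree ≤ k) (hq : q.totalDegree ≤ k) :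
    (p - q).totalDegree ≤ k := (totalDegree_sub _ _).trans (max_le hp hq)
lemma dnum {k : ℕ} (n : ℕ) [n.AtLeastTwo] {p : PA} (hp : p.totalDegree ≤ k) :
    ((OfNat.ofNat n : PA) * p).totalDegree ≤ k := by
  refine (totalDegree_mul _ _).trans ?_
  have : (OfNat.ofNat n : PA) = C (OfNat.ofNat n) := by rw [map_ofNat]
  rw [this, totalDegree_C, zero_add]
  exact hp
lemma dmul (i j : ℕ) {k : ℕ} {p q : PA} (hp : p.totalDegree ≤ i) (hq : q.totalDegree ≤ j)
    (h : i + j ≤ k) : (p * q).totalDegree ≤ k :=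
  (totalDegree_mul _ _).trans ((add_le_add hp hq).trans h)
lemma dpow {i k : ℕ} {p : PA} (hp : p.totalDegree ≤ 1) (h : i ≤ k) : (p ^ i).totalDegree ≤ k := by
  refine (totalDegree_pow _ _).trans (le_trans ?_ h)
  calc i * p.totalDegree ≤ i * 1 := Nat.mul_le_mul_left _ hp
    _ = i := mul_one _

lemma deg_pf (p : PA) (hp : p.totalDegree ≤ 1) : (pf p).totalDegree ≤ 4 := by
  refine dsub (dadd (dsub (dnum 14 (dpow hp ?_)) (dnum 21 (dpow hp ?_))) (dnum 9 (dpow hp ?_)))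
    (hp.trans ?_) <;> norm_num

lemma deg_pg (p q : PA) (hp : p.totalDegree ≤ 1) (hq : q.totalDegree ≤ 1) :
    (pg p q).totalDegree ≤ 4 := by
  have hp' : p.totalDegree ≤ 4 := hp.trans (by norm_num)
  have hq' : q.totalDegree ≤ 4 := hq.trans (by norm_num)
  refine dadd (dadd (dsub (dsub (dadd (dadd (dsub ?_ (dnum 15 (dadd hp' hq')))
    (dnum 45 (dadd (dpow hp ?_) (dpow hq ?_)))) (dnum 180 (dmul 1 1 hp hq ?_)))
    (dnum 35 (dadd (dpow hp ?_) (dpow hq ?_))))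
    (dnum 420 (dadd (dmul 2 1 (dpow hp ?_) hq ?_) (dmul 1 2 hp (dpow hq ?_) ?_))))
    (dnum 280 (dadd (dmul 3 1 (dpow hp ?_) hq ?_) (dmul 1 3 hp (dpow hq ?_) ?_))))
    (dnum 420 (dmul 2 2 (dpow hp ?_) (dpow hq ?_) ?_)) <;> norm_num

lemma deg_pF (p q r s : PA) (hp : p.totalDegree ≤ 1) (hq : q.totalDegree ≤ 1)
    (hr : r.totalDegree ≤ 1) (hs : s.totalDegree ≤ 1) :
    (pF p q r s).totalDegree ≤ 4 := by
  refine dsub (dadd (dsub (dmul 2 2 (dnum 42 (dsub (hp.trans ?_) (dnum 4 (dpow hp ?_))))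
    (dadd (dadd (dmul 1 1 hq hr ?_) (dmul 1 1 hq hs ?_)) (dmul 1 1 hr hs ?_)) ?_)
    (dnum 5 (hp.trans ?_))) (dnum 24 (dpow hp ?_))) (dnum 21 (dpow hp ?_)) <;> norm_num

/-- The properties of barycentric coordinates that are used. -/
structure Bary (a : Fin 4 → E3) (lam : Fin 4 → PA) : Prop where
  deg : ∀ m, (lam m).totalDegree ≤ 1
  ev : ∀ i m, evalP (a i) (lam m) = if i = m then 1 else 0
  aff : ∀ m, ∃ (c : ℝ) (g : Fin 3 → ℝ), ∀ x, evalP x (lam m) = c + ∑ k, g k * x k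

lemma four_cases : ∀ m n r s : Fin 4, m ≠ n → m ≠ r → m ≠ s → n ≠ r → n ≠ s → r ≠ s →
    ∀ i, i = m ∨ i = n ∨ i = r ∨ i = s := by decide

lemma pf_mem {a : Fin 4 → E3} (ha : AffineIndependent ℝ a) {lam : Fin 4 → PA}
    (hl : Bary a lam) (m : Fin 4) : pf (lam m) ∈ B4 a ha := by
  refine ⟨deg_pf _ (hl.deg m), fun i q hq => ?_⟩
  by_cases hi : m = i
  · subst hi
    obtain ⟨n, -, hn, -⟩ := exists_fourth m m m
    obtain ⟨l, k, h1, h2, h3, h4, h5⟩ := exists_third m n hn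
    refine face_zero a ha m l n k h1 hn h2 h3 h4 h5 _ _ orth_zero (fun y => ?_) q hq
    rw [evalP_pf, lam_eval a lam hl.ev hl.aff]
    simp [h1, h2, hn, pf]
  · obtain ⟨l, k, h1, h2, h3, h4, h5⟩ := exists_third i m hi
    refine face_zero a ha i l m k h1 hi h2 h3 h4 h5 _ _ orth_pf (fun y => ?_) q hq
    rw [evalP_pf, lam_eval a lam hl.ev hl.aff]
    simp [h3, h5.symm]

lemma pg_comm (p q : PA) : pg p q = pg q p := by unfold pg; ring

lemma pg_mem {a : Fin 4 → E3} (ha : AffineIndependent ℝ a) {lam : Fin 4 → PA}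
    (hl : Bary a lam) (m n : Fin 4) (hmn : m ≠ n) : pg (lam m) (lam n) ∈ B4 a ha := by
  refine ⟨deg_pg _ _ (hl.deg m) (hl.deg n), fun i q hq => ?_⟩
  have main : ∀ m n : Fin 4, m ≠ n →
      ∫ x in face a n, evalP x (pg (lam m) (lam n)) * evalP x q ∂(μH[2]) = 0 := by
    intro m n hmn
    obtain ⟨l, k, h1, h2, h3, h4, h5⟩ := exists_third n m hmn
    refine face_zero a ha n l m k h1 hmn h2 h3 h4 h5 _ _ orth_pg0 (fun y => ?_) q hq
    rw [evalP_pg, lam_eval a lam hl.ev hl.aff, lam_eval a lam hl.ev hl.aff]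
    simp [h3, h5.symm, h1, h2, hmn]
  by_cases hi : n = i
  · subst hi
    exact main m n hmn
  by_cases hi' : m = i
  · subst hi'
    rw [pg_comm]
    exact main n m hmn.symm
  obtain ⟨l, h1, h2, h3⟩ := exists_fourth i m n
  refine face_zero a ha i l m n h1 hi' hi h2 h3 hmn _ _ orth_pg (fun y => ?_) q hq
  rw [evalP_pg, lam_eval a lam hl.ev hl.aff, lam_eval a lam hl.ev hl.aff]
  simp [h2, h3, hmn, hmn.symm]

lemma pF_mem {a : Fin 4 → E3} (ha : AffineIndependent ℝ a) {lam : Fin 4 → PA}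
    (hl : Bary a lam) (m n r s : Fin 4) (h1 : m ≠ n) (h2 : m ≠ r) (h3 : m ≠ s) (h4 : n ≠ r) (h5 : n ≠ s)
    (h6 : r ≠ s) : pF (lam m) (lam n) (lam r) (lam s) ∈ B4 a ha := by
  refine ⟨deg_pF _ _ _ _ (hl.deg _) (hl.deg _) (hl.deg _) (hl.deg _), fun i q hq => ?_⟩
  have main : ∀ n r s : Fin 4, m ≠ n → m ≠ r → m ≠ s → n ≠ r → n ≠ s → r ≠ s →
      ∫ x in face a s, evalP x (pF (lam m) (lam n) (lam r) (lam s)) * evalP x q ∂(μH[2]) = 0 := by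
    intro n r s h1 h2 h3 h4 h5 h6
    refine face_zero a ha s r m n h6 h3 h5 h2.symm h4.symm h1 _ _ orth_pF (fun y => ?_) q hq
    rw [evalP_pF]
    simp only [lam_eval a lam hl.ev hl.aff]
    simp [h1, h2, h3, h4, h5, h6, h1.symm, h2.symm, h4.symm]
  have hcase : i = m ∨ i = n ∨ i = r ∨ i = s := by
    exact four_cases m n r s h1 h2 h3 h4 h5 h6 i
  rcases hcase with rfl | rfl | rfl | rfl
  · refine face_zero a ha i n r s h1.symm h2.symm h3.symm h4 h5 h6 _ _ orth_zero (fun y => ?_) q hq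
    rw [evalP_pF]
    simp only [lam_eval a lam hl.ev hl.aff]
    simp [h1.symm, h2.symm, h3.symm, pF]
  · rw [show pF (lam m) (lam i) (lam r) (lam s) = pF (lam m) (lam r) (lam s) (lam i) by
      unfold pF; ring]
    exact main r s i h2 h3 h1 h6 h4.symm h5.symm
  · rw [show pF (lam m) (lam n) (lam i) (lam s) = pF (lam m) (lam n) (lam s) (lam i) by
      unfold pF; ring]
    exact main n s i h1 h3 h2 h5 h4 h6.symm
  · exact main n r i h1 h2 h3 h4 h5 h6

lemma pb_mem {a : Fin 4 → E3} (ha : AffineIndependent ℝ a) {lam : Fin 4 → PA}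
    (hl : Bary a lam) (m n r s : Fin 4) (h1 : m ≠ n) (h2 : m ≠ r) (h3 : m ≠ s) (h4 : n ≠ r) (h5 : n ≠ s)
    (h6 : r ≠ s) : lam m * lam n * lam r * lam s ∈ B4 a ha := by
  refine ⟨dmul 3 1 (dmul 2 1 (dmul 1 1 (hl.deg _) (hl.deg _) le_rfl) (hl.deg _) le_rfl)
    (hl.deg _) le_rfl, fun i q hq => ?_⟩
  have main : ∀ m n r s : Fin 4, m ≠ n → m ≠ r → m ≠ s → n ≠ r → n ≠ s → r ≠ s →
      ∫ x in face a s, evalP x (lam m * lam n * lam r * lam s) * evalP x q ∂(μH[2]) = 0 := by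
    intro m n r s h1 h2 h3 h4 h5 h6
    refine face_zero a ha s m n r h3 h5 h6 h1 h2 h4 _ _ orth_zero (fun y => ?_) q hq
    simp only [evalP_mul, lam_eval a lam hl.ev hl.aff]
    simp [h3, h5, h6]
  have hcase : i = m ∨ i = n ∨ i = r ∨ i = s := by
    exact four_cases m n r s h1 h2 h3 h4 h5 h6 i
  rcases hcase with rfl | rfl | rfl | rfl
  · rw [show lam i * lam n * lam r * lam s = lam n * lam r * lam s * lam i by ring]
    exact main n r s i h4 h5 h1.symm h6 h2.symm h3.symm
  · rw [show lam m * lam i * lam r * lam s = lam m * lam r * lam s * lam i by ring]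
    exact main m r s i h2 h3 h1 h6 h4.symm h5.symm
  · rw [show lam m * lam n * lam i * lam s = lam m * lam n * lam s * lam i by ring]
    exact main m n s i h1 h3 h2 h5 h4 h6.symm
  · exact main m n r i h1 h2 h3 h4 h5 h6

/-- Constants plus divergences of fields with components in the bubble space. -/
def RR (a : Fin 4 → E3) (ha : AffineIndependent ℝ a) : Submodule ℝ PA where
  carrier := {p | ∃ (c : ℝ) (v : Fin 3 → PA), (∀ k, v k ∈ B4 a ha) ∧
    p = C c + ∑ k, pderiv k (v k)}
  zero_mem' := ⟨0, 0, fun _ => (B4 a ha).zero_mem, by simp⟩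
  add_mem' := by
    rintro _ _ ⟨c, v, hv, rfl⟩ ⟨d, w, hw, rfl⟩
    refine ⟨c + d, v + w, fun k => (B4 a ha).add_mem (hv k) (hw k), ?_⟩
    simp only [Pi.add_apply, map_add, Finset.sum_add_distrib]
    ring
  smul_mem' := by
    rintro r _ ⟨c, v, hv, rfl⟩
    refine ⟨r * c, r • v, fun k => (B4 a ha).smul_mem r (hv k), ?_⟩
    simp only [Pi.smul_apply, Derivation.map_smul, ← Finset.smul_sum, smul_add]
    congr 1
    simp [smul_eq_C_mul]

lemma one_mem_RR (a : Fin 4 → E3) (ha : AffineIndependent ℝ a) : (1 : PA) ∈ RR a ha :=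
  ⟨1, 0, fun _ => (B4 a ha).zero_mem, by simp⟩

lemma Dd_mem_RR (a : Fin 4 → E3) (ha : AffineIndependent ℝ a) (j : Fin 3) {s : PA}
    (hs : s ∈ B4 a ha) : Dd a j s ∈ RR a ha := by
  refine ⟨0, fun k => (a j.succ k - a 0 k) • s, fun k => (B4 a ha).smul_mem _ hs, ?_⟩
  rw [Dd_apply]
  simp

lemma sum_perm (f : Fin 3 → PA) (i j k : Fin 3) (hij : i ≠ j) (hik : i ≠ k) (hjk : j ≠ k) :
    ∑ l, f l = f i + f j + f k := by
  have h : (Finset.univ : Finset (Fin 3)) = {i, j, k} := by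
    revert i j k
    decide
  rw [h, Finset.sum_insert (by simp [hij, hik]), Finset.sum_insert (by simp [hjk]),
    Finset.sum_singleton, add_assoc]

lemma key_perm {a : Fin 4 → E3} (ha : AffineIndependent ℝ a) {lam : Fin 4 → PA}
    (hl : Bary a lam) (hsum : ∑ m, lam m = 1)
    (hD : ∀ i j : Fin 3, Dd a i (lam j.succ) = if i = j then 1 else 0)
    (i j k : Fin 3) (hij : i ≠ j) (hik : i ≠ k) (hjk : j ≠ k) :
    lam i.succ ∈ RR a ha ∧ lam i.succ ^ 2 ∈ RR a ha ∧ lam i.succ * lam j.succ ∈ RR a ha ∧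
    lam i.succ ^ 3 ∈ RR a ha ∧ lam i.succ ^ 2 * lam j.succ ∈ RR a ha ∧
    lam i.succ * lam j.succ * lam k.succ ∈ RR a ha := by
  have e1 : i.succ ≠ j.succ := fun h => hij (Fin.succ_injective _ h)
  have e2 : i.succ ≠ k.succ := fun h => hik (Fin.succ_injective _ h)
  have e3 : j.succ ≠ k.succ := fun h => hjk (Fin.succ_injective _ h)
  have z1 : i.succ ≠ 0 := Fin.succ_ne_zero _
  have z2 : j.succ ≠ 0 := Fin.succ_ne_zero _
  have z3 : k.succ ≠ 0 := Fin.succ_ne_zero _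
  refine key_mem (RR a ha) (B4 a ha) (Dd a i) (Dd a j) (Dd a k) (lam i.succ) (lam j.succ)
    (lam k.succ) (lam 0) ?_ ?_ ?_ ?_ ?_ ?_ ?_ ?_ ?_ ?_ (Dd_mem_RR a ha i) (Dd_mem_RR a ha j)
    (Dd_mem_RR a ha k) (one_mem_RR a ha) (pf_mem ha hl _) (pf_mem ha hl _) (pf_mem ha hl _)
    (pF_mem ha hl _ _ _ _ e1 e2 z1 e3 z2 z3) (pF_mem ha hl _ _ _ _ e1.symm e3 z2 e2 z1 z3)
    (pF_mem ha hl _ _ _ _ e2.symm e3.symm z3 e1 z1 z2)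
    (pF_mem ha hl _ _ _ _ z1.symm z2.symm z3.symm e1 e2 e3)
    (pg_mem ha hl _ _ e1) (pg_mem ha hl _ _ e2) (pg_mem ha hl _ _ z1) (pg_mem ha hl _ _ e3)
    (pg_mem ha hl _ _ z2) (pg_mem ha hl _ _ z3) (pb_mem ha hl _ _ _ _ e1 e2 z1 e3 z2 z3)
  · rw [← hsum, Fin.sum_univ_succ, sum_perm (fun l => lam l.succ) i j k hij hik hjk]
    ring
  all_goals rw [hD]
  all_goals simp [hij, hik, hjk, hij.symm, hik.symm, hjk.symm]

lemma mono_mem (R : Submodule ℝ PA) (L : Fin 3 → PA) (h1 : (1 : PA) ∈ R)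
    (h : ∀ i j k : Fin 3, i ≠ j → i ≠ k → j ≠ k →
      L i ∈ R ∧ L i ^ 2 ∈ R ∧ L i * L j ∈ R ∧ L i ^ 3 ∈ R ∧ L i ^ 2 * L j ∈ R ∧
      L i * L j * L k ∈ R) (r s t : ℕ) (hd : r + s + t ≤ 3) :
    L 0 ^ r * L 1 ^ s * L 2 ^ t ∈ R := by
  obtain ⟨a1, a2, a3, a4, a5, a6⟩ := h 0 1 2 (by decide) (by decide) (by decide)
  obtain ⟨-, -, b3, -, b5, -⟩ := h 0 2 1 (by decide) (by decide) (by decide)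
  obtain ⟨c1, c2, c3, c4, c5, -⟩ := h 1 2 0 (by decide) (by decide) (by decide)
  obtain ⟨-, -, -, -, d5, -⟩ := h 1 0 2 (by decide) (by decide) (by decide)
  obtain ⟨f1, f2, -, f4, f5, -⟩ := h 2 0 1 (by decide) (by decide) (by decide)
  obtain ⟨-, -, -, -, g5, -⟩ := h 2 1 0 (by decide) (by decide) (by decide)
  rw [mul_comm] at d5 f5 g5
  have hr : r ≤ 3 := by omega
  have hs : s ≤ 3 := by omega
  have ht : t ≤ 3 := by omega
  interval_cases r <;> interval_cases s <;> interval_cases t <;>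
    first | omega | (simp only [pow_zero, pow_one, one_mul, mul_one, h1, a1, a2, a3, a4, a5, a6,
      b3, b5, c1, c2, c3, c4, c5, d5, f1, f2, f4, f5, g5])

lemma mem_RR {a : Fin 4 → E3} (ha : AffineIndependent ℝ a) (p : PA) (hp : p.totalDegree ≤ 3) :
    p ∈ RR a ha := by
  obtain ⟨lam, h1, h2, h3, h4, h5, h6, -⟩ := exists_bary a ha
  have hl : Bary a lam := ⟨h1, h3, h4⟩
  set p' : PA := bind₁ (fun k => (C (a 0 k) + ∑ j : Fin 3, C (a j.succ k - a 0 k) * X j : PA)) p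
    with hp'
  have hd : p'.totalDegree ≤ 3 := (deg_bind _ (fun k => deg_aff _ _) p).trans hp
  have hpp : p = bind₁ (fun j : Fin 3 => lam j.succ) p' := by
    rw [hp', bind₁_bind₁]
    conv_lhs => rw [← aeval_X_left_apply p]
    rw [bind₁]
    congr 2
    ext1 k
    rw [h6 k]
    simp
  rw [hpp, bind₁, aeval_def, eval₂_eq']
  refine Submodule.sum_mem _ fun d hdd => ?_
  have hd3 : d 0 + d 1 + d 2 ≤ 3 := by
    have := (le_totalDegree hdd).trans hd
    rwa [Finsupp.sum_fintype _ _ (by simp), Fin.sum_univ_three] at this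
  rw [← Algebra.smul_def, Fin.prod_univ_three]
  exact (RR a ha).smul_mem _ (mono_mem _ (fun j => lam j.succ) (one_mem_RR a ha)
    (key_perm ha hl h2 h5) _ _ _ hd3)

lemma int_div {a : Fin 4 → E3} (ha : AffineIndependent ℝ a) (v : Fin 3 → PA)
    (hv : ∀ k, InB a (v k)) : ∫ y in Sx 3, evalP (ph a y) (∑ k, pderiv k (v k)) = 0 := by
  obtain ⟨lam, -, -, -, -, -, -, β, hβ⟩ := exists_bary a ha
  simp only [evalP_sum]
  rw [integral_finsetSum _ fun k _ => intOn (evalP_ph_cont a _)]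
  refine Finset.sum_eq_zero fun k _ => ?_
  rw [hβ]
  simp only [evalP_sum, evalP_smul]
  rw [integral_finsetSum _ fun j _ => intOn (by exact (evalP_ph_cont a _).const_mul _)]
  refine Finset.sum_eq_zero fun j _ => ?_
  rw [integral_const_mul, div_ref a ha, mul_zero]
  intro i
  simpa using (hv k).2 i 1 (by simp)

lemma deg_pderiv (k : Fin 3) (p : PA) (hp : p.totalDegree ≤ 4) :
    (pderiv k p).totalDegree ≤ 3 := by
  conv_lhs => rw [p.as_sum]
  rw [map_sum]
  refine totalDegree_finsetSum_le fun d hd => ?_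
  have h1 : d 0 + d 1 + d 2 ≤ 4 := by
    have := (le_totalDegree hd).trans hp
    rwa [Finsupp.sum_fintype _ _ (by simp), Fin.sum_univ_three] at this
  rw [pderiv_monomial]
  by_cases hk : d k = 0
  · simp [hk]
  refine (totalDegree_monomial_le _ _).trans ?_
  rw [Finsupp.sum_fintype _ _ (by simp), Fin.sum_univ_three]
  fin_cases k <;> simp at hk ⊢ <;> omega

lemma vol_ne : ∫ _y in Sx 3, (1 : ℝ) ≠ 0 := by
  have h : 0 < volume (Sx 3) := by
    refine lt_of_lt_of_le ?_ (measure_mono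
      (s := Set.pi Set.univ fun _ : Fin 3 => Set.Ioo (0 : ℝ) (1 / 3)) ?_)
    · rw [Real.volume_pi_Ioo]
      simp only [sub_zero, Finset.prod_const]
      exact ENNReal.pow_pos (by simp) _
    · intro y hy
      simp only [Set.mem_pi, Set.mem_univ, Set.mem_Ioo, true_imp_iff] at hy
      refine ⟨fun i => (hy i).1.le, ?_⟩
      rw [Fin.sum_univ_three]
      linarith [(hy 0).2, (hy 1).2, (hy 2).2]
  have hf : volume (Sx 3) ≠ ⊤ := (Sx_compact 3).measure_lt_top.ne
  simp only [integral_const, MeasurableSet.univ, measureReal_restrict_apply, Set.univ_inter,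
    smul_eq_mul, mul_one]
  exact (ENNReal.toReal_pos h.ne' hf).ne'

/-- `div 𝔅₄(T)³` equals the mean-zero part of `P₃(T)`. -/
theorem stmt12 (a : Fin 4 → E3) (hind : AffineIndependent ℝ a) :
    {d : MvPolynomial (Fin 3) ℝ | ∃ v : Fin 3 → MvPolynomial (Fin 3) ℝ,
        (∀ k, (v k).totalDegree ≤ 4 ∧
          ∀ (i : Fin 4) (q : MvPolynomial (Fin 3) ℝ), q.totalDegree ≤ 2 →
            ∫ x in face a i, evalP x (v k) * evalP x q ∂(μH[2]) = 0) ∧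
        d = ∑ k, MvPolynomial.pderiv k (v k)}
      = {p : MvPolynomial (Fin 3) ℝ | p.totalDegree ≤ 3 ∧
          ∫ x in tetra a, evalP x p = 0} := by
  obtain ⟨c, hc, hT⟩ := tetra_int a hind
  ext p
  constructor
  · rintro ⟨v, hv, rfl⟩
    refine ⟨totalDegree_finsetSum_le fun k _ => deg_pderiv k _ (hv k).1, ?_⟩
    rw [hT, int_div hind v hv, mul_zero]
  · rintro ⟨hp, hi⟩
    obtain ⟨r, v, hv, rfl⟩ := mem_RR hind p hp
    refine ⟨v, hv, ?_⟩
    rw [hT, mul_eq_zero, or_iff_right hc] at hi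
    simp only [evalP_add, evalP_C] at hi
    rw [integral_add (intOn continuous_const) (intOn (evalP_ph_cont a _)), int_div hind v hv,
      add_zero] at hi
    have hr : r = 0 := by
      have h2 : ∫ y in Sx 3, r = r * ∫ y in Sx 3, (1 : ℝ) := by
        rw [← integral_const_mul]; simp
      rw [h2, mul_eq_zero, or_iff_left vol_ne] at hi
      exact hi
    rw [hr]
    simp
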